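/- For every ε > 0 there exists C = C(ε) ≥ 1 with the following property. Let F be a finite field with char(F) > 2 and |F| ≥ C, let P0 ⊆ F^4 with |P0| ≤ |F|^(3 + 1/16 + ε), and let L0 be a family of lines of F^4 pointing in different directions with |L0| ≥ |F|³ such that every line of L0 is contained in P0. Then there exist a real number α with C⁻¹ ≤ α ≤ C·|F|^(1/16 + ε), a subset P1 ⊆ P0, and a subset L1 ⊆ L0 such that: (1) |{(p,l) ∈ P1 × L1 : p ∈ l}| ≥ C⁻¹·|F|^(4 − ε); (2) |P1| ≤ C·|F|^ε·α·|F|³; (3) for every p ∈ P1, C⁻¹·|F|^(−ε)·α⁻¹·|F| ≤ |{l ∈ L1 : p ∈ l}| ≤ C·|F|^ε·α⁻¹·|F|; (4) for every 3-dimensional affine subspace λ ⊆ F^4, |{l ∈ L1 : l ⊆ λ}| ≤ C·|F|^ε·α²·|F|; (5) for every 2-dimensional affine subspace π ⊆ F^4, |{l ∈ L1 : l ⊆ π}| ≤ C·|F|^ε·α⁴. -/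

import Mathlib

open Set

/-- A line in `F^n`: a set of the form `{x + t • v : t ∈ F}` with `v ≠ 0`. -/
def IsLine (F : Type*) [Field F] {n : ℕ} (l : Set (Fin n → F)) : Prop :=
  ∃ x v : Fin n → F, v ≠ 0 ∧ l = {y | ∃ t : F, y = x + t • v}

/-- A `k`-dimensional affine subspace of `F^n`: a translate of a `k`-dimensional
linear subspace. -/
def IsAffineDim (F : Type*) [Field F] {n : ℕ} (k : ℕ) (V : Set (Fin n → F)) : Prop :=
  ∃ (W : Submodule F (Fin n → F)) (x : Fin n → F),
    Module.finrank F W = k ∧ V = (fun w => x + w) '' (W : Set (Fin n → F))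

/-- `B` is a translate of `A`. -/
def IsTranslate (F : Type*) [Field F] {n : ℕ} (A B : Set (Fin n → F)) : Prop :=
  ∃ c : Fin n → F, B = (fun x => x + c) '' A

/-- A family of lines points in different directions: no two of its (distinct)
members are translates of one another. -/
def DiffDirections (F : Type*) [Field F] {n : ℕ} (L : Set (Set (Fin n → F))) : Prop :=
  ∀ l₁ ∈ L, ∀ l₂ ∈ L, l₁ ≠ l₂ → ¬ IsTranslate F l₁ l₂

/-- Two lines are skew if they are not contained in a common 2-dimensional affine
subspace. -/
def SkewLines (F : Type*) [Field F] {n : ℕ} (l₁ l₂ : Set (Fin n → F)) : Prop :=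
  ¬ ∃ V : Set (Fin n → F), IsAffineDim F 2 V ∧ l₁ ⊆ V ∧ l₂ ⊆ V

/-- A frame in `F^4`: a 3-dimensional affine subspace `lam` together with three
pairwise skew lines contained in it. -/
def IsFrame (F : Type*) [Field F] (l₁ l₂ l₃ lam : Set (Fin 4 → F)) : Prop :=
  IsLine F l₁ ∧ IsLine F l₂ ∧ IsLine F l₃ ∧ IsAffineDim F 3 lam ∧
  l₁ ⊆ lam ∧ l₂ ⊆ lam ∧ l₃ ⊆ lam ∧
  SkewLines F l₁ l₂ ∧ SkewLines F l₁ l₃ ∧ SkewLines F l₂ l₃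

/-- The set `L(f)` of all lines of `F^4` intersecting each of `l₁`, `l₂`, `l₃`. -/
def frameLines (F : Type*) [Field F] (l₁ l₂ l₃ : Set (Fin 4 → F)) :
    Set (Set (Fin 4 → F)) :=
  {l | IsLine F l ∧ (l ∩ l₁).Nonempty ∧ (l ∩ l₂).Nonempty ∧ (l ∩ l₃).Nonempty}

/-- The regulus `r(f)`: the union of the lines in `L(f)`. -/
def regulus (F : Type*) [Field F] (l₁ l₂ l₃ : Set (Fin 4 → F)) : Set (Fin 4 → F) :=
  ⋃ l ∈ frameLines F l₁ l₂ l₃, l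


/-- parametrised line with direction `v`. -/
def HasDir (F : Type*) [Field F] {n : ℕ} (l : Set (Fin n → F)) (v : Fin n → F) : Prop :=
  v ≠ 0 ∧ ∃ x : Fin n → F, l = {y | ∃ t : F, y = x + t • v}

lemma line_hasDir {F : Type*} [Field F] {n : ℕ} {l : Set (Fin n → F)} (h : IsLine F l) :
    ∃ v, HasDir F l v := by
  obtain ⟨x, v, hv, rfl⟩ := h
  exact ⟨v, hv, x, rfl⟩

lemma hasDir_smul {F : Type*} [Field F] {n : ℕ} {l : Set (Fin n → F)} {v : Fin n → F}
    (h : HasDir F l v) (t : F) (ht : t ≠ 0) : HasDir F l (t • v) := by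
  obtain ⟨hv, x, rfl⟩ := h
  refine ⟨smul_ne_zero ht hv, x, ?_⟩
  ext y
  constructor
  · rintro ⟨s, rfl⟩
    exact ⟨s * t⁻¹, by rw [smul_smul]; simp [ht]⟩
  · rintro ⟨s, rfl⟩
    exact ⟨s * t, by rw [smul_smul]⟩

lemma hasDir_translate {F : Type*} [Field F] {n : ℕ} {l l' : Set (Fin n → F)} {v : Fin n → F}
    (h : HasDir F l v) (h' : HasDir F l' v) : IsTranslate F l l' := by
  obtain ⟨hv, x, rfl⟩ := h
  obtain ⟨-, x', rfl⟩ := h'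
  refine ⟨x' - x, ?_⟩
  ext y
  constructor
  · rintro ⟨s, rfl⟩
    exact ⟨x + s • v, ⟨s, rfl⟩, by simp; abel⟩
  · rintro ⟨_, ⟨s, rfl⟩, rfl⟩
    exact ⟨s, by simp; abel⟩

lemma dir_count {F : Type*} [Field F] [Fintype F] {n : ℕ} (L : Set (Set (Fin n → F)))
    (hL : ∀ l ∈ L, IsLine F l) (hd : DiffDirections F L) (S : Set (Fin n → F))
    (hS : ∀ l ∈ L, ∀ v, HasDir F l v → v ∈ S) :
    L.ncard * (Fintype.card F - 1) ≤ S.ncard := by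
  classical
  choose! v hv using fun l (hl : l ∈ L) => line_hasDir (hL l hl)
  have e : L.ncard * (Fintype.card F - 1) = (L ×ˢ ({0}ᶜ : Set F)).ncard := by
    rw [Set.ncard_prod, Set.ncard_compl, Set.ncard_singleton, Nat.card_eq_fintype_card]
  rw [e]
  refine Set.ncard_le_ncard_of_injOn (fun a => a.2 • v a.1) ?_ ?_ (Set.toFinite _)
  · rintro ⟨l, t⟩ ⟨hl, ht⟩
    exact hS l hl _ (hasDir_smul (hv l hl) t ht)
  · rintro ⟨l, t⟩ ⟨hl, ht⟩ ⟨l', t'⟩ ⟨hl', ht'⟩ h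
    simp only at h hl ht hl' ht'
    have : l = l' := by
      by_contra hne
      refine hd l hl l' hl' hne (hasDir_translate (hasDir_smul (hv l hl) t ht) ?_)
      rw [h]
      exact hasDir_smul (hv l' hl') t' ht'
    subst this
    have := smul_left_injective F (hv l hl).1 h
    simp [this]

lemma hasDir_mem_of_subset {F : Type*} [Field F] {n : ℕ} {l : Set (Fin n → F)} {v : Fin n → F}
    (h : HasDir F l v) (W : Submodule F (Fin n → F)) (x : Fin n → F)
    (hl : l ⊆ (fun w => x + w) '' (W : Set (Fin n → F))) : v ∈ W := by
  obtain ⟨hv, y, rfl⟩ := h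
  obtain ⟨a, ha, ha'⟩ := hl (show y ∈ _ from ⟨0, by simp⟩)
  obtain ⟨b, hb, hb'⟩ := hl (show y + v ∈ _ from ⟨1, by simp⟩)
  have : v = b - a := by
    simp only at ha' hb'
    have : x + b = x + a + v := by rw [hb', ha']
    rw [add_assoc] at this
    rw [add_left_cancel this]; simp
  rw [this]
  exact W.sub_mem hb ha

lemma affine_count {F : Type*} [Field F] [Fintype F] {n k : ℕ} (L : Set (Set (Fin n → F)))
    (hL : ∀ l ∈ L, IsLine F l) (hd : DiffDirections F L) (V : Set (Fin n → F))
    (hV : IsAffineDim F k V) :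
    {l ∈ L | l ⊆ V}.ncard * (Fintype.card F - 1) ≤ Fintype.card F ^ k := by
  classical
  obtain ⟨W, x, hW, rfl⟩ := hV
  have := dir_count {l ∈ L | l ⊆ (fun w => x + w) '' (W : Set (Fin n → F))}
    (fun l hl => hL l hl.1) (fun a ha b hb => hd a ha.1 b hb.1) (W : Set (Fin n → F))
    (fun l hl v hv => hasDir_mem_of_subset hv W x hl.2)
  refine this.trans (le_of_eq ?_)
  have h2 := Module.card_eq_pow_finrank (K := F) (V := W)
  rw [hW] at h2
  rw [← h2, ← Nat.card_eq_fintype_card]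
  rfl

lemma hasDir_of_two {F : Type*} [Field F] {n : ℕ} {l : Set (Fin n → F)} (h : IsLine F l)
    {p p' : Fin n → F} (hp : p ∈ l) (hp' : p' ∈ l) (hne : p ≠ p') :
    l = {y | ∃ t : F, y = p + t • (p' - p)} := by
  obtain ⟨x, v, hv, rfl⟩ := h
  obtain ⟨a, rfl⟩ := hp
  obtain ⟨b, rfl⟩ := hp'
  have hab : b - a ≠ 0 := by
    intro h
    rw [sub_eq_zero] at h
    exact hne (by rw [h])
  have e : x + b • v - (x + a • v) = (b - a) • v := by module
  rw [e]
  ext y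
  constructor
  · rintro ⟨t, rfl⟩
    refine ⟨(t - a) / (b - a), ?_⟩
    rw [smul_smul, div_mul_cancel₀ _ hab]; module
  · rintro ⟨t, rfl⟩
    exact ⟨a + t * (b - a), by module⟩

lemma line_inter {F : Type*} [Field F] [Fintype F] {n : ℕ} {l l' : Set (Fin n → F)}
    (h : IsLine F l) (h' : IsLine F l') (hne : l ≠ l') : (l ∩ l').ncard ≤ 1 := by
  rw [Set.ncard_le_one]
  rintro a ⟨ha, ha'⟩ b ⟨hb, hb'⟩
  by_contra hab
  exact hne ((hasDir_of_two h ha hb hab).trans (hasDir_of_two h' ha' hb' hab).symm)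

lemma line_card {F : Type*} [Field F] [Fintype F] {n : ℕ} {l : Set (Fin n → F)}
    (h : IsLine F l) : l.ncard = Fintype.card F := by
  obtain ⟨x, v, hv, rfl⟩ := h
  have : {y | ∃ t : F, y = x + t • v} = (fun t : F => x + t • v) '' Set.univ := by
    ext y; simp [eq_comm]
  rw [this, Set.ncard_image_of_injective, Set.ncard_univ, Nat.card_eq_fintype_card]
  exact (add_right_injective x).comp (smul_left_injective F hv)

open Polynomial in
lemma top_coeff {F : Type*} [Field F] (p : MvPolynomial (Fin 4) F) (x v : Fin 4 → F) :
    (MvPolynomial.aeval (fun i => C (x i) + C (v i) * X : Fin 4 → F[X]) p).natDegree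
        ≤ p.totalDegree ∧
    (MvPolynomial.aeval (fun i => C (x i) + C (v i) * X : Fin 4 → F[X]) p).coeff p.totalDegree
      = MvPolynomial.eval v (MvPolynomial.homogeneousComponent p.totalDegree p) := by
  have hlin : ∀ i (m : ℕ), ((C (x i) + C (v i) * X : F[X]) ^ m).natDegree ≤ m := by
    intro i m
    have h1 : (C (x i) + C (v i) * X : F[X]).natDegree ≤ 1 := by compute_degree
    exact (natDegree_pow_le_of_le m h1).trans (by simp)
  have hc : ∀ i (m : ℕ), ((C (x i) + C (v i) * X : F[X]) ^ m).coeff m = v i ^ m := by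
    intro i m
    have := coeff_pow_of_natDegree_le (p := (C (x i) + C (v i) * X : F[X])) (m := m) (n := 1)
      (by compute_degree)
    simpa using this
  have hdeg : ∀ d : Fin 4 →₀ ℕ,
      (∏ i, (C (x i) + C (v i) * X : F[X]) ^ d i).natDegree ≤ d.degree := by
    intro d
    refine (natDegree_prod_le _ _).trans ?_
    rw [Finsupp.degree_eq_sum]
    exact Finset.sum_le_sum fun i _ => hlin i _
  have hco : ∀ d : Fin 4 →₀ ℕ,
      (∏ i, (C (x i) + C (v i) * X : F[X]) ^ d i).coeff d.degree = ∏ i, v i ^ d i := by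
    intro d
    rw [Finsupp.degree_eq_sum]
    have : ∀ s : Finset (Fin 4), (∏ i ∈ s, (C (x i) + C (v i) * X : F[X]) ^ d i).natDegree
        ≤ ∑ i ∈ s, d i ∧ (∏ i ∈ s, (C (x i) + C (v i) * X : F[X]) ^ d i).coeff (∑ i ∈ s, d i)
        = ∏ i ∈ s, v i ^ d i := by
      intro s
      induction s using Finset.induction_on with
      | empty => simp
      | insert a s ha ih =>
        rw [Finset.prod_insert ha, Finset.sum_insert ha, Finset.prod_insert ha]
        refine ⟨natDegree_mul_le_of_le (hlin _ _) ih.1, ?_⟩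
        rw [coeff_mul_add_eq_of_natDegree_le (hlin _ _) ih.1, hc, ih.2]
    exact (this Finset.univ).2
  have hle : ∀ d ∈ p.support, d.degree ≤ p.totalDegree := fun d hd => by
    have := MvPolynomial.le_totalDegree hd
    exact this
  rw [MvPolynomial.aeval_def, MvPolynomial.eval₂_eq']
  constructor
  · refine natDegree_sum_le_of_forall_le _ _ fun d hd => ?_
    exact (natDegree_C_mul_le _ _).trans ((hdeg d).trans (hle d hd))
  · rw [finsetSum_coeff, MvPolynomial.homogeneousComponent_apply, map_sum, Finset.sum_filter]
    refine Finset.sum_congr rfl fun d hd => ?_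
    rw [algebraMap_eq, coeff_C_mul]
    split_ifs with h
    · rw [← h, hco, MvPolynomial.eval_monomial, Finsupp.prod_fintype]
      simp
    · rw [coeff_eq_zero_of_natDegree_lt, mul_zero]
      exact (hdeg d).trans_lt (lt_of_le_of_ne (hle d hd) h)

lemma exists_poly {F : Type*} [Field F] [Fintype F] (k : ℕ) (P : Set (Fin 4 → F))
    (hP : P.ncard < (k + 1) ^ 4) :
    ∃ p : MvPolynomial (Fin 4) F, p ≠ 0 ∧ p.totalDegree ≤ 4 * k ∧
      ∀ x ∈ P, MvPolynomial.eval x p = 0 := by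
  classical
  let ex : (Fin 4 → Fin (k + 1)) → (Fin 4 →₀ ℕ) :=
    fun d => Finsupp.equivFunOnFinite.symm fun i => (d i : ℕ)
  have hex : Function.Injective ex := by
    intro a b h
    ext i
    exact DFunLike.congr_fun h i
  let T : ((Fin 4 → Fin (k + 1)) → F) →ₗ[F] MvPolynomial (Fin 4) F :=
    ∑ d, (MvPolynomial.monomial (ex d)).comp (LinearMap.proj d)
  have hT : ∀ c, T c = ∑ d, MvPolynomial.monomial (ex d) (c d) := by
    intro c; simp [T]
  let E : MvPolynomial (Fin 4) F →ₗ[F] (P → F) :=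
    LinearMap.pi fun x => (MvPolynomial.aeval (x : Fin 4 → F)).toLinearMap
  have hker : LinearMap.ker (E ∘ₗ T) ≠ ⊥ := by
    apply LinearMap.ker_ne_bot_of_finrank_lt
    rw [Module.finrank_fintype_fun_eq_card, Module.finrank_fintype_fun_eq_card]
    rw [← Nat.card_eq_fintype_card, Nat.card_coe_set_eq]
    simpa using hP
  obtain ⟨c, hc, hc0⟩ := (Submodule.ne_bot_iff _).mp hker
  refine ⟨T c, ?_, ?_, ?_⟩
  · intro h
    apply hc0
    ext d
    have := congrArg (MvPolynomial.coeff (ex d)) h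
    rw [hT, MvPolynomial.coeff_sum] at this
    simpa [MvPolynomial.coeff_monomial, hex.eq_iff] using this
  · rw [hT]
    refine MvPolynomial.totalDegree_finsetSum_le fun d _ => ?_
    refine (MvPolynomial.totalDegree_monomial_le _ _).trans ?_
    rw [Finsupp.sum_fintype _ _ (by simp)]
    refine (Finset.sum_le_sum (g := fun _ => k) fun i _ => ?_).trans (by simp)
    exact Nat.lt_succ_iff.mp (d i).2
  · intro x hx
    have := congrFun (LinearMap.mem_ker.mp hc) ⟨x, hx⟩
    simpa [E] using! this

lemma dvir {F : Type*} [Field F] [Fintype F] (P : Set (Fin 4 → F)) (L : Set (Set (Fin 4 → F)))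
    (hL : ∀ l ∈ L, IsLine F l) (hd : DiffDirections F L) (hc : Fintype.card F ^ 3 ≤ L.ncard)
    (hP : ∀ l ∈ L, l ⊆ P) (k : ℕ) (hk : 4 * k + 2 ≤ Fintype.card F) : (k + 1) ^ 4 ≤ P.ncard := by
  classical
  by_contra! hlt
  obtain ⟨p, hp0, hdeg, hz⟩ := exists_poly k P hlt
  set h := MvPolynomial.homogeneousComponent p.totalDegree p with hh
  have hh0 : h ≠ 0 := by
    have : p.support.Nonempty := by simpa using hp0
    obtain ⟨d, hd, he⟩ := Finset.exists_mem_eq_sup p.support this (fun s => s.sum fun _ e => e)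
    intro h0
    have := congrArg (MvPolynomial.coeff d) h0
    rw [hh, MvPolynomial.coeff_homogeneousComponent, if_pos] at this
    · exact (MvPolynomial.mem_support_iff.mp hd) (by simpa using this)
    · exact he.symm
  have hhd : h.totalDegree ≤ 4 * k :=
    ((MvPolynomial.homogeneousComponent_isHomogeneous _ _).totalDegree_le).trans hdeg
  have key := dir_count L hL hd {v | MvPolynomial.eval v h = 0} (by
    rintro l hl v ⟨hv, x, rfl⟩
    have tc := top_coeff p x v
    have : (MvPolynomial.aeval (fun i => Polynomial.C (x i) + Polynomial.C (v i) * Polynomial.X :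
        Fin 4 → Polynomial F) p) = 0 := by
      apply Polynomial.eq_zero_of_natDegree_lt_card_of_eval_eq_zero _ (f := (id : F → F))
        Function.injective_id
      · intro t
        have h1 := hz _ (hP _ hl ⟨t, rfl⟩)
        rw [← Polynomial.coe_evalRingHom, MvPolynomial.aeval_def, MvPolynomial.eval₂_eq']
        rw [MvPolynomial.eval_eq'] at h1
        rw [map_sum, ← h1]
        refine Finset.sum_congr rfl fun d _ => ?_
        rw [map_mul, map_prod]
        simp only [Polynomial.coe_evalRingHom, Polynomial.algebraMap_eq, Polynomial.eval_C,
          Polynomial.eval_pow, Polynomial.eval_add, Polynomial.eval_mul, Polynomial.eval_X,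
          Pi.add_apply, Pi.smul_apply, smul_eq_mul]
        simp only [mul_comm t, id_eq]
      · have := tc.1; omega
    rw [this] at tc
    simpa using tc.2.symm)
  have sz := MvPolynomial.schwartz_zippel_totalDegree hh0 (Finset.univ : Finset F)
  have hset : ({v | MvPolynomial.eval v h = 0} : Set (Fin 4 → F)).ncard
      = (Finset.filter (fun f => MvPolynomial.eval f h = 0)
        (Fintype.piFinset fun _ : Fin 4 => (Finset.univ : Finset F))).card := by
    rw [Set.ncard_eq_toFinset_card']
    congr 1
    ext; simp
  rw [← hset, Finset.card_univ] at sz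
  set Z := ({v | MvPolynomial.eval v h = 0} : Set (Fin 4 → F)).ncard
  set q := Fintype.card F
  have hq : 0 < q := Fintype.card_pos
  have sz2 : Z ≤ h.totalDegree * q ^ 3 := by
    rw [div_le_div_iff₀ (by positivity) (by positivity)] at sz
    have sz' : Z * q ≤ h.totalDegree * q ^ 4 := by exact_mod_cast sz
    have : Z * q ≤ (h.totalDegree * q ^ 3) * q := by rw [mul_assoc]; exact sz'
    exact Nat.le_of_mul_le_mul_right this hq
  have h1 : q ^ 3 * (q - 1) ≤ q ^ 3 * (4 * k) := by
    calc q ^ 3 * (q - 1) ≤ L.ncard * (q - 1) := Nat.mul_le_mul_right _ hc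
      _ ≤ Z := key
      _ ≤ _ := sz2
      _ ≤ 4 * k * q ^ 3 := Nat.mul_le_mul_right _ hhd
      _ = _ := by ring
  have := Nat.le_of_mul_le_mul_left h1 (by positivity)
  omega

open Classical in
lemma second_moment {F : Type*} [Field F] [Fintype F] (Lf : Finset (Set (Fin 4 → F)))
    (hL : ∀ l ∈ Lf, IsLine F l) :
    (∑ p : Fin 4 → F, (Lf.filter (fun l => p ∈ l)).card ^ 2 ≤
      Lf.card ^ 2 + Lf.card * Fintype.card F) ∧
    ∑ p : Fin 4 → F, (Lf.filter (fun l => p ∈ l)).card = Lf.card * Fintype.card F := by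
  have hc : ∀ (s : Set (Fin 4 → F)) [DecidablePred (· ∈ s)], ∑ p : Fin 4 → F, (if p ∈ s then 1 else 0) = s.ncard := by
    intro s _
    rw [← Finset.card_filter, Set.ncard_eq_toFinset_card']
    congr 1
    ext; simp
  constructor
  · have e : ∀ p : Fin 4 → F, (Lf.filter (fun l => p ∈ l)).card ^ 2
        = ∑ l ∈ Lf, ∑ l' ∈ Lf, if p ∈ l ∩ l' then 1 else 0 := by
      intro p
      rw [sq, Finset.card_filter, Finset.sum_mul_sum]
      refine Finset.sum_congr rfl fun l _ => Finset.sum_congr rfl fun l' _ => ?_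
      by_cases h1 : p ∈ l <;> by_cases h2 : p ∈ l' <;> simp [h1, h2]
    simp_rw [e]
    rw [Finset.sum_comm]
    have : ∀ l ∈ Lf, ∑ p : Fin 4 → F, ∑ l' ∈ Lf, (if p ∈ l ∩ l' then 1 else 0)
        ≤ Lf.card + Fintype.card F := by
      intro l hl
      rw [Finset.sum_comm]
      simp_rw [hc]
      have : ∀ l' ∈ Lf, (l ∩ l').ncard ≤ 1 + if l = l' then Fintype.card F else 0 := by
        intro l' hl'
        split_ifs with h
        · subst h
          rw [Set.inter_self, line_card (hL l hl)]; omega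
        · simpa using line_inter (hL l hl) (hL l' hl') h
      refine (Finset.sum_le_sum this).trans ?_
      rw [Finset.sum_add_distrib, Finset.sum_ite_eq]
      simp [hl]
    refine (Finset.sum_le_sum this).trans (le_of_eq ?_)
    simp; ring
  · simp_rw [Finset.card_filter]
    rw [Finset.sum_comm]
    simp_rw [hc]
    rw [Finset.sum_congr rfl fun l hl => line_card (hL l hl)]
    simp

lemma refine_inc {F : Type*} [Field F] [Fintype F] (L : Set (Set (Fin 4 → F)))
    (hL : ∀ l ∈ L, IsLine F l) (m : ℝ) (hm : 0 < m) :
    (L.ncard : ℝ) * Fintype.card F - ((L.ncard : ℝ) ^ 2 + L.ncard * Fintype.card F) / m ≤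
    ({pl : (Fin 4 → F) × Set (Fin 4 → F) |
      pl.1 ∈ {p | 1 ≤ {l ∈ L | p ∈ l}.ncard ∧ ({l ∈ L | p ∈ l}.ncard : ℝ) ≤ m} ∧
        pl.2 ∈ L ∧ pl.1 ∈ pl.2}.ncard : ℝ) := by
  classical
  obtain ⟨Lf, rfl⟩ : ∃ Lf : Finset (Set (Fin 4 → F)), L = (Lf : Set _) :=
    ⟨(Set.toFinite L).toFinset, by simp⟩
  simp only [Finset.mem_coe] at hL
  have hmu : ∀ p : Fin 4 → F, {l ∈ (Lf : Set (Set (Fin 4 → F))) | p ∈ l}.ncard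
      = (Lf.filter (fun l => p ∈ l)).card := by
    intro p
    rw [← Set.ncard_coe_finset]
    congr 1
    ext; simp
  simp only [hmu, Set.ncard_coe_finset]
  obtain ⟨h2, h1⟩ := second_moment Lf hL
  set mu : (Fin 4 → F) → ℕ := fun p => (Lf.filter (fun l => p ∈ l)).card with hmudef
  have h2' : ∑ p, (mu p : ℝ) ^ 2 ≤ (Lf.card : ℝ) ^ 2 + Lf.card * Fintype.card F := by
    exact_mod_cast h2
  have h1' : ∑ p, (mu p : ℝ) = (Lf.card : ℝ) * Fintype.card F := by
    exact_mod_cast h1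
  let A : Finset (Fin 4 → F) := Finset.univ.filter fun p => 1 ≤ mu p ∧ (mu p : ℝ) ≤ m
  have hA : ((∑ p ∈ A, mu p : ℕ) : ℝ) ≤ ({pl : (Fin 4 → F) × Set (Fin 4 → F) |
      pl.1 ∈ {p | 1 ≤ mu p ∧ (mu p : ℝ) ≤ m} ∧
        pl.2 ∈ (Lf : Set (Set (Fin 4 → F))) ∧ pl.1 ∈ pl.2}.ncard : ℝ) := by
    norm_cast
    have : ∑ p ∈ A, mu p = (A.sigma fun p => Lf.filter (fun l => p ∈ l)).card := by
      rw [Finset.card_sigma]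
    rw [this, ← Set.ncard_coe_finset]
    refine Set.ncard_le_ncard_of_injOn (fun a => (a.1, a.2)) ?_ ?_ (Set.toFinite _)
    · rintro ⟨p, l⟩ h
      simp only [Finset.coe_sigma, Set.mem_sigma_iff, Finset.mem_coe, Finset.mem_filter, A,
        Finset.mem_univ, true_and] at h
      exact ⟨h.1, h.2.1, h.2.2⟩
    · rintro ⟨p, l⟩ _ ⟨p', l'⟩ _ h
      simp only [Prod.mk.injEq] at h
      obtain ⟨rfl, rfl⟩ := h
      rfl
  refine le_trans ?_ hA
  push_cast
  rw [Finset.sum_filter]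
  have : ∀ p, (mu p : ℝ) - (mu p : ℝ) ^ 2 / m ≤
      if 1 ≤ mu p ∧ (mu p : ℝ) ≤ m then (mu p : ℝ) else 0 := by
    intro p
    split_ifs with h
    · have : 0 ≤ (mu p : ℝ) ^ 2 / m := by positivity
      linarith
    · by_cases h0 : mu p = 0
      · simp [h0]
      · have hgt : m < mu p := by
          by_contra! hle
          exact h ⟨Nat.one_le_iff_ne_zero.mpr h0, hle⟩
        rw [sub_nonpos, le_div_iff₀ hm]
        nlinarith
  refine le_trans ?_ (Finset.sum_le_sum fun p _ => this p)
  rw [Finset.sum_sub_distrib, ← Finset.sum_div, h1']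
  have := div_le_div_of_nonneg_right h2' hm.le
  linarith

lemma count_le {q c k : ℕ} (hq : 2 ≤ q) (h : c * (q - 1) ≤ q ^ (k + 1)) :
    (c : ℝ) ≤ 2 * (q : ℝ) ^ k := by
  have h1 : c * q ≤ 2 * q ^ k * q := by
    have : c * q ≤ 2 * (c * (q - 1)) := by
      have : q ≤ 2 * (q - 1) := by omega
      calc c * q ≤ c * (2 * (q - 1)) := Nat.mul_le_mul_left _ this
        _ = _ := by ring
    calc _ ≤ _ := this
      _ ≤ 2 * q ^ (k + 1) := Nat.mul_le_mul_left _ h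
      _ = _ := by ring
  have := Nat.le_of_mul_le_mul_right h1 (by omega)
  exact_mod_cast this

/-- preliminary refinement of a Besicovitch-type configuration. -/
theorem preliminary_refinement :
    ∀ ε : ℝ, 0 < ε → ∃ C : ℝ, 1 ≤ C ∧
      ∀ (F : Type) [Field F] [Fintype F], 2 < ringChar F →
        C ≤ (Fintype.card F : ℝ) →
        ∀ (P₀ : Set (Fin 4 → F)) (L₀ : Set (Set (Fin 4 → F))),
          (P₀.ncard : ℝ) ≤ (Fintype.card F : ℝ) ^ ((3 : ℝ) + 1 / 16 + ε) →
          (∀ l ∈ L₀, IsLine F l) → DiffDirections F L₀ →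
          (Fintype.card F : ℝ) ^ (3 : ℕ) ≤ (L₀.ncard : ℝ) →
          (∀ l ∈ L₀, l ⊆ P₀) →
          ∃ (α : ℝ) (P₁ : Set (Fin 4 → F)) (L₁ : Set (Set (Fin 4 → F))),
            C⁻¹ ≤ α ∧ α ≤ C * (Fintype.card F : ℝ) ^ ((1 : ℝ) / 16 + ε) ∧
            P₁ ⊆ P₀ ∧ L₁ ⊆ L₀ ∧
            -- (1) many incidences
            C⁻¹ * (Fintype.card F : ℝ) ^ ((4 : ℝ) - ε) ≤
              ({pl : (Fin 4 → F) × Set (Fin 4 → F) |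
                  pl.1 ∈ P₁ ∧ pl.2 ∈ L₁ ∧ pl.1 ∈ pl.2}.ncard : ℝ) ∧
            -- (2) cardinality bound
            (P₁.ncard : ℝ) ≤ C * (Fintype.card F : ℝ) ^ ε * α *
              (Fintype.card F : ℝ) ^ (3 : ℕ) ∧
            -- (3) multiplicity bounds
            (∀ p ∈ P₁,
              C⁻¹ * (Fintype.card F : ℝ) ^ (-ε) * α⁻¹ * (Fintype.card F : ℝ) ≤
                ({l ∈ L₁ | p ∈ l}.ncard : ℝ) ∧
              ({l ∈ L₁ | p ∈ l}.ncard : ℝ) ≤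
                C * (Fintype.card F : ℝ) ^ ε * α⁻¹ * (Fintype.card F : ℝ)) ∧
            -- (4) no 3-space degeneracy
            (∀ lam : Set (Fin 4 → F), IsAffineDim F 3 lam →
              ({l ∈ L₁ | l ⊆ lam}.ncard : ℝ) ≤
                C * (Fintype.card F : ℝ) ^ ε * α ^ (2 : ℕ) * (Fintype.card F : ℝ)) ∧
            -- (5) no 2-plane degeneracy
            (∀ pl : Set (Fin 4 → F), IsAffineDim F 2 pl →
              ({l ∈ L₁ | l ⊆ pl}.ncard : ℝ) ≤
                C * (Fintype.card F : ℝ) ^ ε * α ^ (4 : ℕ)) := by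
  intro ε hε
  rcases lt_or_ge ε (15 / 16) with hlt | hge
  · have hδ : 0 < 15 / 16 - ε := by linarith
    refine ⟨(4097 : ℝ) ^ (1 / (15 / 16 - ε)), Real.one_le_rpow (by norm_num) (by positivity), ?_⟩
    intro F _ _ hchar hC P₀ L₀ hP hL hd hLc hLP
    exfalso
    have hq2 : 2 ≤ Fintype.card F := Fintype.one_lt_card
    have hdv := dvir P₀ L₀ hL hd (by exact_mod_cast hLc) hLP ((Fintype.card F - 2) / 4) (by omega)
    have hk : Fintype.card F ≤ 8 * ((Fintype.card F - 2) / 4 + 1) := by omega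
    set q := Fintype.card F
    have hq0 : (0 : ℝ) < q := by positivity
    have h1 : q ^ 4 ≤ 4096 * P₀.ncard := by
      calc q ^ 4 ≤ (8 * ((q - 2) / 4 + 1)) ^ 4 := Nat.pow_le_pow_left hk 4
        _ = 4096 * ((q - 2) / 4 + 1) ^ 4 := by ring
        _ ≤ _ := Nat.mul_le_mul_left _ hdv
    have h2 : (q : ℝ) ^ 4 ≤ 4096 * P₀.ncard := by exact_mod_cast h1
    have h3 : (q : ℝ) ^ (4 : ℕ) = (q : ℝ) ^ ((3 : ℝ) + 1 / 16 + ε) * (q : ℝ) ^ (15 / 16 - ε) := by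
      rw [← Real.rpow_add hq0, ← Real.rpow_natCast]
      congr 1; push_cast; ring
    have h4 : (4097 : ℝ) ≤ (q : ℝ) ^ (15 / 16 - ε) := by
      calc (4097 : ℝ) = ((4097 : ℝ) ^ (1 / (15 / 16 - ε))) ^ (15 / 16 - ε) := by
            rw [← Real.rpow_mul (by norm_num), one_div_mul_cancel hδ.ne', Real.rpow_one]
        _ ≤ _ := Real.rpow_le_rpow (by positivity) hC hδ.le
    have h5 : 0 < (q : ℝ) ^ ((3 : ℝ) + 1 / 16 + ε) := by positivity
    rw [h3] at h2
    nlinarith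
  · refine ⟨1296, by norm_num, ?_⟩
    intro F _ _ hchar hC P₀ L₀ hP hL hd hLc hLP
    have hq2 : 2 ≤ Fintype.card F := Fintype.one_lt_card
    have hcardV : Fintype.card (Fin 4 → F) = Fintype.card F ^ 4 := by simp
    have hcount3 := fun (L : Set (Set (Fin 4 → F))) (h : L ⊆ L₀) (V : Set (Fin 4 → F))
      (hV : IsAffineDim F 3 V) => count_le (k := 2) hq2 (affine_count (k := 3) L
        (fun l hl => hL l (h hl)) (fun a ha b hb => hd a (h ha) b (h hb)) V hV)
    have hcount2 := fun (L : Set (Set (Fin 4 → F))) (h : L ⊆ L₀) (V : Set (Fin 4 → F))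
      (hV : IsAffineDim F 2 V) => count_le (k := 1) hq2 (affine_count (k := 2) L
        (fun l hl => hL l (h hl)) (fun a ha b hb => hd a (h ha) b (h hb)) V hV)
    have hri := fun (L : Set (Set (Fin 4 → F))) (h : L ⊆ L₀) =>
      refine_inc L (fun l hl => hL l (h hl))
    set q : ℝ := (Fintype.card F : ℝ) with hqdef
    have hq1 : (1 : ℝ) ≤ q := by linarith
    have hq0 : (0 : ℝ) < q := by linarith
    have mono : ∀ {a b : ℝ}, a ≤ b → q ^ a ≤ q ^ b := fun h =>
      Real.rpow_le_rpow_of_exponent_le hq1 h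
    have one_le : ∀ {a : ℝ}, 0 ≤ a → 1 ≤ q ^ a := fun h => Real.one_le_rpow hq1 h
    have h6 : 6 ≤ q ^ (3 / 8 : ℝ) := by
      calc (6 : ℝ) = ((6 : ℝ) ^ (4 : ℝ)) ^ (1 / 4 : ℝ) := by
            rw [← Real.rpow_mul (by norm_num)]; norm_num
        _ ≤ q ^ (1 / 4 : ℝ) := by
            apply Real.rpow_le_rpow (by positivity) _ (by norm_num)
            norm_num; linarith
        _ ≤ _ := mono (by norm_num)
    obtain ⟨L₁, hL₁, hN⟩ : ∃ L₁ ⊆ L₀, L₁.ncard = ⌈q ^ (5 / 2 : ℝ)⌉₊ := by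
      apply Set.exists_subset_card_eq
      rw [Nat.ceil_le]
      refine le_trans ?_ hLc
      rw [← Real.rpow_natCast]
      exact mono (by norm_num)
    have hNl : q ^ (5 / 2 : ℝ) ≤ L₁.ncard := by rw [hN]; exact Nat.le_ceil _
    have hNu : (L₁.ncard : ℝ) ≤ 2 * q ^ (5 / 2 : ℝ) := by
      rw [hN]
      have := (Nat.ceil_lt_add_one (show 0 ≤ q ^ (5 / 2 : ℝ) by positivity)).le
      have := one_le (show (0 : ℝ) ≤ 5 / 2 by norm_num)
      linarith
    have hm0 : 0 < q ^ (15 / 8 : ℝ) := by positivity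
    obtain ⟨β, hβ0, hβ1, hβ2, hβ3⟩ : ∃ β : ℝ, 0 ≤ β ∧ 1 ≤ ε + β ∧ β ≤ 1 / 16 ∧
        15 / 8 ≤ 1 + ε - β := by
      refine ⟨max 0 (1 - ε), le_max_left _ _, ?_, ?_, ?_⟩
      · linarith [le_max_right 0 (1 - ε)]
      · exact max_le (by norm_num) (by linarith)
      · rcases max_cases 0 (1 - ε) with h | h <;> linarith
    have hα0 : 0 < q ^ β := by positivity
    have hN0 : (0 : ℝ) ≤ L₁.ncard := by positivity
    have n1 : (1 : ℝ) ≤ 1296 := by norm_num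
    refine ⟨q ^ β, {p | 1 ≤ {l ∈ L₁ | p ∈ l}.ncard ∧
      ({l ∈ L₁ | p ∈ l}.ncard : ℝ) ≤ q ^ (15 / 8 : ℝ)}, L₁, ?_, ?_, ?_, hL₁, ?_, ?_, ?_, ?_, ?_⟩
    · linarith [one_le hβ0, show (1296 : ℝ)⁻¹ ≤ 1 by norm_num]
    · have := mono (show β ≤ 1 / 16 + ε by linarith)
      nlinarith
    · rintro p ⟨hp, -⟩
      obtain ⟨l, hl, hpl⟩ := (Set.ncard_pos (Set.toFinite _)).mp hp
      exact hLP l (hL₁ hl) hpl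
    · refine le_trans ?_ (hri L₁ hL₁ _ hm0)
      have e1 : q ^ (5 / 2 : ℝ) * q ^ (3 / 8 : ℝ) = q * q ^ (15 / 8 : ℝ) := by
        rw [← Real.rpow_add hq0]
        nth_rewrite 2 [← Real.rpow_one q]
        rw [← Real.rpow_add hq0]; norm_num
      have e2 : q ≤ q ^ (5 / 2 : ℝ) := by
        nth_rewrite 1 [← Real.rpow_one q]; exact mono (by norm_num)
      have e3 : (L₁.ncard : ℝ) + q ≤ q * q ^ (15 / 8 : ℝ) / 2 := by
        rw [← e1]
        have : 0 < q ^ (5 / 2 : ℝ) := by positivity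
        nlinarith
      have e4 : ((L₁.ncard : ℝ) ^ 2 + L₁.ncard * q) / q ^ (15 / 8 : ℝ) ≤ L₁.ncard * q / 2 := by
        rw [div_le_iff₀ hm0]
        nlinarith [mul_le_mul_of_nonneg_left e3 hN0]
      have e5 : q ^ (4 - ε) ≤ q ^ (5 / 2 : ℝ) * q := by
        nth_rewrite 3 [← Real.rpow_one q]
        rw [← Real.rpow_add hq0]
        exact mono (by linarith)
      have e6 : q ^ (5 / 2 : ℝ) * q ≤ L₁.ncard * q := mul_le_mul_of_nonneg_right hNl hq0.le
      have e7 : 0 < q ^ (4 - ε) := by positivity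
      linarith
    · have : ∀ S : Set (Fin 4 → F), (S.ncard : ℝ) ≤ q ^ 4 := by
        intro S
        have := Set.ncard_le_card S
        rw [Nat.card_eq_fintype_card, hcardV] at this
        rw [hqdef]
        exact_mod_cast this
      refine (this _).trans ?_
      have e1 : q ≤ q ^ ε * q ^ β := by
        rw [← Real.rpow_add hq0]
        nth_rewrite 1 [← Real.rpow_one q]; exact mono hβ1
      calc q ^ 4 = 1 * q * q ^ 3 := by ring
        _ ≤ 1296 * (q ^ ε * q ^ β) * q ^ 3 := by gcongr
        _ = _ := by ring
    · rintro p ⟨hp1, hp2⟩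
      constructor
      · have e1 : q ^ (-ε) * (q ^ β)⁻¹ * q ≤ 1 := by
          rw [← Real.rpow_neg hq0.le, ← Real.rpow_add hq0]
          nth_rewrite 2 [← Real.rpow_one q]
          rw [← Real.rpow_add hq0]
          exact Real.rpow_le_one_of_one_le_of_nonpos hq1 (by linarith)
        have e2 : (1 : ℝ) ≤ ({l ∈ L₁ | p ∈ l}.ncard : ℝ) := by exact_mod_cast hp1
        have e3 : 0 < q ^ (-ε) * (q ^ β)⁻¹ * q := by positivity
        refine le_trans ?_ e2
        rw [mul_assoc, mul_assoc, ← mul_assoc (q ^ (-ε))]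
        linarith
      · refine hp2.trans ?_
        have e1 : q ^ (15 / 8 : ℝ) ≤ q ^ ε * (q ^ β)⁻¹ * q := by
          rw [← Real.rpow_neg hq0.le, ← Real.rpow_add hq0]
          nth_rewrite 3 [← Real.rpow_one q]
          rw [← Real.rpow_add hq0]
          exact mono (by linarith)
        rw [mul_assoc, mul_assoc, ← mul_assoc (q ^ ε)]
        linarith
    · intro lam hlam
      refine (hcount3 L₁ hL₁ lam hlam).trans ?_
      have e1 : q ≤ q ^ ε * q ^ β := by
        rw [← Real.rpow_add hq0]
        nth_rewrite 1 [← Real.rpow_one q]; exact mono hβ1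
      have e2 := one_le hβ0
      calc 2 * q ^ 2 = 2 * (q * 1) * q := by ring
        _ ≤ 1296 * ((q ^ ε * q ^ β) * q ^ β) * q := by gcongr; norm_num
        _ = _ := by ring
    · intro pl hpl
      refine (hcount2 L₁ hL₁ pl hpl).trans ?_
      have e1 : q ≤ q ^ ε * q ^ β := by
        rw [← Real.rpow_add hq0]
        nth_rewrite 1 [← Real.rpow_one q]; exact mono hβ1
      have e2 := one_le hβ0
      calc 2 * q ^ 1 = 2 * (q * 1 ^ 3) := by ring
        _ ≤ 1296 * ((q ^ ε * q ^ β) * (q ^ β) ^ 3) := by gcongr; norm_num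
        _ = _ := by ring
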